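/- arXiv:1701.07184 — 2 statements merged into one kernel-verified Lean document; each statement's English description precedes it below -/
import Mathlib

section
/- Every codeword of C3 that is not the all-zero vector has Hamming weight at least min(n - k + 2t + 1, 2(n - k - t + 1)). In particular, if 4t ≤ n - k + 1 then every nonzero codeword of C3 has Hamming weight at least n - k + 2t + 1, and if 4t > n - k + 1 then every nonzero codeword of C3 has Hamming weight at least 2(n - k - t + 1). -/
open Polynomial

lemma split_zero {F : Type*} [Field F] (m : ℕ) (A B : F[X])
    (hA : A.degree < (m : WithBot ℕ)) (h : A + X ^ m * B = 0) : A = 0 ∧ B = 0 := by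
  have hA0 : A = 0 := by
    apply Polynomial.eq_zero_of_dvd_of_degree_lt (p := X ^ m)
    · exact ⟨-B, by linear_combination h⟩
    · simpa using hA
  subst hA0
  refine ⟨rfl, ?_⟩
  simpa using h

lemma block_zero {F : Type*} [Field F] (k t : ℕ) (h2t : 2 * t < k) (A B C D : F[X])
    (hA : A.degree < (t : WithBot ℕ)) (hB : B.degree < (t : WithBot ℕ))
    (hC : C.degree < ((k - 2 * t : ℕ) : WithBot ℕ))
    (h : A + X ^ t * B + X ^ (2 * t) * C + X ^ k * D = 0) :
    A = 0 ∧ B = 0 ∧ C = 0 ∧ D = 0 := by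
  obtain ⟨r, rfl⟩ : ∃ r, k = 2 * t + r := ⟨k - 2 * t, by omega⟩
  have hr : 2 * t + r - 2 * t = r := by omega
  rw [hr] at hC
  obtain ⟨h1, h2⟩ := split_zero t A (B + X ^ t * (C + X ^ r * D)) hA
    (by rw [← h]; ring)
  obtain ⟨h3, h4⟩ := split_zero t B _ hB h2
  obtain ⟨h5, h6⟩ := split_zero r C _ hC h4
  exact ⟨h1, h3, h5, h6⟩

lemma weight_bound {F : Type*} [Field F] [DecidableEq F] (n d : ℕ) (α : F)
    (hα : orderOf α = n) (p : F[X]) (hp : p ≠ 0) (hd : p.degree < (d : WithBot ℕ))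
    (w : Fin n → F) (h : ∀ i : Fin n, w i = 0 → p.eval (α ^ (i : ℕ)) = 0) :
    n + 1 ≤ hammingNorm w + d := by
  have hinj : Function.Injective (fun i : Fin n => α ^ (i : ℕ)) := by
    intro a b hab
    apply Fin.ext
    apply pow_injOn_Iio_orderOf (x := α)
    · simp [hα]
    · simp [hα]
    · exact hab
  have hz : (Finset.univ.filter (fun i : Fin n => w i = 0)).card ≤ p.natDegree := by
    rw [← Finset.card_image_of_injective _ hinj]
    apply Polynomial.card_le_degree_of_subset_roots
    intro x hx
    rw [Finset.mem_val, Finset.mem_image] at hx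
    obtain ⟨i, hi, rfl⟩ := hx
    rw [Polynomial.mem_roots hp]
    exact h i (by simpa using hi)
  have hs := Finset.card_filter_add_card_filter_not (s := (Finset.univ : Finset (Fin n)))
    (fun i : Fin n => w i = 0)
  have hn : hammingNorm w = (Finset.univ.filter (fun i : Fin n => ¬ w i = 0)).card := rfl
  have hd' : p.natDegree < d := (Polynomial.natDegree_lt_iff_degree_lt hp).2 hd
  simp only [Finset.card_univ, Fintype.card_fin] at hs
  omega

/-- Theorem 2: every nonzero codeword of `C3` has Hamming weight at least
`min (n - k + 2t + 1) (2(n - k - t + 1))`. -/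
theorem C3_min_distance
    (F : Type*) [Field F] [Fintype F] [DecidableEq F]
    (n k t : ℕ) (hn : 0 < n) (hk : 0 < k) (ht : 0 < t)
    (h2t : 2 * t < k) (hkt : k + t ≤ n)
    (hdvd : n ∣ Fintype.card F - 1)
    (α : F) (hα : orderOf α = n)
    -- the information vector: for each sub-unit j, polynomials V_{j,1}, V_{j,2}
    -- of degree ≤ t-1 and V_{j,I} of degree ≤ k-2t-1
    (V1 V2 VI : Fin 3 → F[X])
    (hV1 : ∀ j, (V1 j).degree < (t : WithBot ℕ))
    (hV2 : ∀ j, (V2 j).degree < (t : WithBot ℕ))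
    (hVI : ∀ j, (VI j).degree < ((k - 2 * t : ℕ) : WithBot ℕ))
    -- the sub-block polynomials c_j
    (c : Fin 3 → F[X])
    (hc : ∀ j, c j = V1 j + X ^ t * V2 j + X ^ (2 * t) * VI j
          + X ^ k * (V1 (j + 1) + V2 (j + 2)))
    -- the sub-blocks of the codeword: evaluations of c_j at α^0, …, α^{n-1}
    (w : Fin 3 → Fin n → F)
    (hw : ∀ j (i : Fin n), w j i = (c j).eval (α ^ (i : ℕ)))
    (hnz : ∃ j : Fin 3, w j ≠ 0) :
    min (n - k + 2 * t + 1) (2 * (n - k - t + 1)) ≤ ∑ j : Fin 3, hammingNorm (w j) := by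
  have hα0 : α ≠ 0 := by
    rintro rfl
    have := pow_orderOf_eq_one (0 : F)
    rw [hα, zero_pow hn.ne'] at this
    exact zero_ne_one this
  have hmul : ∀ (m e : ℕ) (p : F[X]), p.degree < (e : WithBot ℕ) → m + e ≤ k + t →
      X ^ m * p ∈ degreeLT F (k + t) := by
    intro m e p hp hme
    rw [mem_degreeLT]
    by_cases h0 : p = 0
    · subst h0; simp [WithBot.bot_lt_coe]
    · have h1 := (natDegree_lt_iff_degree_lt h0).2 hp
      rw [← natDegree_lt_iff_degree_lt (mul_ne_zero (pow_ne_zero _ X_ne_zero) h0),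
        natDegree_mul (pow_ne_zero _ X_ne_zero) h0, natDegree_X_pow]
      omega
  have hdeg : ∀ j, (c j).degree < ((k + t : ℕ) : WithBot ℕ) := by
    intro j
    rw [← mem_degreeLT, hc]
    refine add_mem (add_mem (add_mem ?_ ?_) ?_) ?_
    · simpa using hmul 0 t _ (hV1 j) (by omega)
    · exact hmul t t _ (hV2 j) (by omega)
    · exact hmul (2 * t) (k - 2 * t) _ (hVI j) (by omega)
    · exact hmul k t _ ((degree_add_le _ _).trans_lt (max_lt (hV1 _) (hV2 _))) le_rfl
  have hwt : ∀ j, c j ≠ 0 → n + 1 ≤ hammingNorm (w j) + (k + t) := fun j hj =>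
    weight_bound n (k + t) α hα (c j) hj (hdeg j) (w j) (fun i hi => by rw [← hw, hi])
  -- if two of the three blocks vanish, the remaining one is heavy
  have hone : ∀ j, w j ≠ 0 → c (j + 1) = 0 → c (j + 2) = 0 →
      n + 1 ≤ hammingNorm (w j) + (k - 2 * t) := by
    intro j hj h1 h2
    have e1 : j + 1 + 1 = j + 2 := by fin_cases j <;> rfl
    have e2 : j + 1 + 2 = j := by fin_cases j <;> rfl
    have e3 : j + 2 + 1 = j := by fin_cases j <;> rfl
    have e4 : j + 2 + 2 = j + 1 := by fin_cases j <;> rfl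
    rw [hc] at h1 h2
    rw [e1, e2] at h1
    rw [e3, e4] at h2
    obtain ⟨a1, a2, -, a4⟩ := block_zero k t h2t _ _ _ _ (hV1 _) (hV2 _) (hVI _) h1
    obtain ⟨b1, b2, -, b4⟩ := block_zero k t h2t _ _ _ _ (hV1 _) (hV2 _) (hVI _) h2
    rw [b1, zero_add] at a4
    rw [a2, add_zero] at b4
    have hcj : c j = X ^ (2 * t) * VI j := by
      rw [hc, a4, b4, a1, b2]; simp
    have hVj : VI j ≠ 0 := by
      intro h0
      apply hj
      funext i
      rw [hw, hcj, h0]; simp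
    refine weight_bound n (k - 2 * t) α hα (VI j) hVj (hVI j) (w j) ?_
    intro i hi
    rw [hw, hcj, eval_mul, eval_pow, eval_X] at hi
    exact (mul_eq_zero.1 hi).resolve_left (pow_ne_zero _ (pow_ne_zero _ hα0))
  have hsum : ∀ j : Fin 3, ∑ i : Fin 3, hammingNorm (w i)
      = hammingNorm (w j) + hammingNorm (w (j + 1)) + hammingNorm (w (j + 2)) := by
    intro j
    rw [Fin.sum_univ_three]
    fin_cases j
    · rfl
    · change _ = hammingNorm (w 1) + hammingNorm (w 2) + hammingNorm (w 0)
      omega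
    · change _ = hammingNorm (w 2) + hammingNorm (w 0) + hammingNorm (w 1)
      omega
  obtain ⟨j, hj⟩ := hnz
  have hcj : c j ≠ 0 := by
    intro h0
    apply hj
    funext i
    rw [hw, h0]; simp
  have hj0 := hwt j hcj
  rw [hsum j]
  by_cases h1 : c (j + 1) = 0
  · by_cases h2 : c (j + 2) = 0
    · have := hone j hj h1 h2
      omega
    · have := hwt _ h2
      omega
  · have := hwt _ h1
    omega
end

section
/- The code K3 admits sub-block reverse mapping: for every j ∈ {1,2,3}, if two information vectors produce K3 codewords whose sub-blocks j are equal (as vectors in F^n), then the two information vectors have the same sub-unit j, i.e., V_{j,1} = V'_{j,1}, V_{j,2} = V'_{j,2}, V_{j,3} = V'_{j,3}, V_{j,4} = V'_{j,4}, and V_{j,I} = V'_{j,I}. In particular, the k information symbols of sub-unit j are uniquely determined by sub-block j of the codeword. -/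
open Polynomial

theorem K3_peel {F : Type*} [Field F] (m : ℕ) (A B A' B' : F[X])
    (hA : A.degree < (m : WithBot ℕ)) (hA' : A'.degree < (m : WithBot ℕ))
    (h : A + X ^ m * B = A' + X ^ m * B') : A = A' ∧ B = B' := by
  have h1 : A = A' := by
    ext i
    by_cases hi : i < m
    · have := congrArg (fun p => p.coeff i) h
      simpa [coeff_X_pow_mul', not_le.mpr hi] using this
    · have hm : (m : WithBot ℕ) ≤ (i : WithBot ℕ) := by exact_mod_cast not_lt.mp hi
      rw [coeff_eq_zero_of_degree_lt (hA.trans_le hm),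
        coeff_eq_zero_of_degree_lt (hA'.trans_le hm)]
  refine ⟨h1, ?_⟩
  rw [h1] at h
  exact mul_left_cancel₀ (pow_ne_zero m X_ne_zero) (add_left_cancel h)

theorem K3_deg_add {F : Type*} [Field F] {m : ℕ} {A B : F[X]}
    (hA : A.degree < (m : WithBot ℕ)) (hB : B.degree < (m : WithBot ℕ)) :
    (A + B).degree < (m : WithBot ℕ) :=
  (degree_add_le A B).trans_lt (max_lt hA hB)

theorem K3_deg_shift {F : Type*} [Field F] {m t n : ℕ} {A : F[X]}
    (hA : A.degree < (m : WithBot ℕ)) (h : t + m ≤ n) :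
    (X ^ t * A).degree < (n : WithBot ℕ) := by
  rw [degree_lt_iff_coeff_zero] at hA ⊢
  intro i hi
  rw [coeff_X_pow_mul', if_pos (by omega)]
  exact hA _ (by omega)

theorem K3_deg {F : Type*} [Field F] (n k s : ℕ) 
    (h4s : 4 * s < k) (hks : k + 2 * s ≤ n) (a b d e f g h : F[X])
    (ha : a.degree < (s : WithBot ℕ)) (hb : b.degree < (s : WithBot ℕ))
    (hd : d.degree < (s : WithBot ℕ)) (he : e.degree < (s : WithBot ℕ))
    (hf : f.degree < ((k - 4 * s : ℕ) : WithBot ℕ))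
    (hg : g.degree < (s : WithBot ℕ)) (hh : h.degree < (s : WithBot ℕ)) :
    (a + X ^ s * b + X ^ (2 * s) * d + X ^ (3 * s) * e + X ^ (4 * s) * f
      + X ^ k * g + X ^ (k + s) * h).degree < (n : WithBot ℕ) := by
  refine K3_deg_add (K3_deg_add (K3_deg_add (K3_deg_add (K3_deg_add (K3_deg_add ?_ 
    (K3_deg_shift hb ?_)) (K3_deg_shift hd ?_)) (K3_deg_shift he ?_)) (K3_deg_shift hf ?_))
    (K3_deg_shift hg ?_)) (K3_deg_shift hh ?_)
  · exact ha.trans_le (by exact_mod_cast (by omega : s ≤ n))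
  all_goals omega

/-- `K3` admits sub-block reverse mapping: if two information vectors produce codewords
whose sub-blocks `j` agree, then their sub-units `j` agree. -/
theorem K3_reverse_mapping
    (F : Type*) [Field F] [Fintype F] [DecidableEq F]
    (n k s : ℕ) (hn : 0 < n) (hk : 0 < k) (hs : 0 < s)
    (h4s : 4 * s < k) (hks : k + 2 * s ≤ n)
    (hdvd : n ∣ Fintype.card F - 1)
    (α : F) (hα : orderOf α = n)
    -- the information vector: for each sub-unit j, polynomials V_{j,1},…,V_{j,4}
    -- of degree ≤ s-1 and V_{j,I} of degree ≤ k-4s-1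
    (V1 V2 V3 V4 VI : Fin 3 → F[X])
    (hV1 : ∀ j, (V1 j).degree < (s : WithBot ℕ))
    (hV2 : ∀ j, (V2 j).degree < (s : WithBot ℕ))
    (hV3 : ∀ j, (V3 j).degree < (s : WithBot ℕ))
    (hV4 : ∀ j, (V4 j).degree < (s : WithBot ℕ))
    (hVI : ∀ j, (VI j).degree < ((k - 4 * s : ℕ) : WithBot ℕ))
    -- the sub-block polynomials c_j (indices of sub-units taken mod 3)
    (c : Fin 3 → F[X])
    (hc : ∀ j, c j = V1 j + X ^ s * V2 j + X ^ (2 * s) * (V3 j + V4 j)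
          + X ^ (3 * s) * V4 j + X ^ (4 * s) * VI j
          + X ^ k * (V2 (j - 1) + V3 (j + 1) + V4 (j + 1))
          + X ^ (k + s) * V1 (j - 1))
    -- the sub-blocks of the codeword: evaluations of c_j at α^0, …, α^{n-1}
    (w : Fin 3 → Fin n → F)
    (hw : ∀ j (i : Fin n), w j i = (c j).eval (α ^ (i : ℕ)))
    (V1' V2' V3' V4' VI' : Fin 3 → F[X])
    (hV1' : ∀ j, (V1' j).degree < (s : WithBot ℕ))
    (hV2' : ∀ j, (V2' j).degree < (s : WithBot ℕ))
    (hV3' : ∀ j, (V3' j).degree < (s : WithBot ℕ))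
    (hV4' : ∀ j, (V4' j).degree < (s : WithBot ℕ))
    (hVI' : ∀ j, (VI' j).degree < ((k - 4 * s : ℕ) : WithBot ℕ))
    (c' : Fin 3 → F[X])
    (hc' : ∀ j, c' j = V1' j + X ^ s * V2' j + X ^ (2 * s) * (V3' j + V4' j)
          + X ^ (3 * s) * V4' j + X ^ (4 * s) * VI' j
          + X ^ k * (V2' (j - 1) + V3' (j + 1) + V4' (j + 1))
          + X ^ (k + s) * V1' (j - 1))
    (w' : Fin 3 → Fin n → F)
    (hw' : ∀ j (i : Fin n), w' j i = (c' j).eval (α ^ (i : ℕ))) :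
    ∀ j : Fin 3, w j = w' j → V1 j = V1' j ∧ V2 j = V2' j ∧ V3 j = V3' j ∧ V4 j = V4' j ∧ VI j = VI' j := by
  intro j hj
  have hcc : c j = c' j := by
    refine eq_of_degrees_lt_of_eval_index_eq (s := (Finset.univ : Finset (Fin n)))
      (v := fun i : Fin n => α ^ (i : ℕ)) ?_ ?_ ?_ ?_
    · intro a _ b _ hab
      exact Fin.ext (pow_injOn_Iio_orderOf (by simp [hα]) (by simp [hα]) hab)
    · rw [Finset.card_univ, Fintype.card_fin, hc]
      exact K3_deg n k s h4s hks _ _ _ _ _ _ _ (hV1 _) (hV2 _) (K3_deg_add (hV3 _) (hV4 _))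
        (hV4 _) (hVI _) (K3_deg_add (K3_deg_add (hV2 _) (hV3 _)) (hV4 _)) (hV1 _)
    · rw [Finset.card_univ, Fintype.card_fin, hc']
      exact K3_deg n k s h4s hks _ _ _ _ _ _ _ (hV1' _) (hV2' _) (K3_deg_add (hV3' _) (hV4' _))
        (hV4' _) (hVI' _) (K3_deg_add (K3_deg_add (hV2' _) (hV3' _)) (hV4' _)) (hV1' _)
    · intro i _
      rw [← hw, ← hw', hj]
  rw [hc, hc'] at hcc
  obtain ⟨t, rfl⟩ : ∃ t, k = 4 * s + t := ⟨k - 4 * s, by omega⟩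
  have ht : 4 * s + t - 4 * s = t := by omega
  rw [ht] at hVI hVI'
  obtain ⟨h1, hcc⟩ := K3_peel s (V1 j) (V2 j + X ^ s * ((V3 j + V4 j) + X ^ s * (V4 j + X ^ s *
      (VI j + X ^ t * (V2 (j - 1) + V3 (j + 1) + V4 (j + 1) + X ^ s * V1 (j - 1))))))
    (V1' j) (V2' j + X ^ s * ((V3' j + V4' j) + X ^ s * (V4' j + X ^ s *
      (VI' j + X ^ t * (V2' (j - 1) + V3' (j + 1) + V4' (j + 1) + X ^ s * V1' (j - 1))))))
    (hV1 j) (hV1' j) (by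
      have e : ∀ a b d e f g h : F[X], a + X ^ s * b + X ^ (2 * s) * d + X ^ (3 * s) * e
          + X ^ (4 * s) * f + X ^ (4 * s + t) * g + X ^ (4 * s + t + s) * h
          = a + X ^ s * (b + X ^ s * (d + X ^ s * (e + X ^ s * (f + X ^ t * (g + X ^ s * h))))) := by
        intros; ring
      rw [← e, ← e]; exact hcc)
  obtain ⟨h2, hcc⟩ := K3_peel s _ _ _ _ (hV2 j) (hV2' j) hcc
  obtain ⟨h3, hcc⟩ := K3_peel s _ _ _ _ (K3_deg_add (hV3 j) (hV4 j))
    (K3_deg_add (hV3' j) (hV4' j)) hcc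
  obtain ⟨h4, hcc⟩ := K3_peel s _ _ _ _ (hV4 j) (hV4' j) hcc
  obtain ⟨h5, -⟩ := K3_peel t _ _ _ _ (hVI j) (hVI' j) hcc
  rw [h4] at h3
  exact ⟨h1, h2, add_right_cancel h3, h4, h5⟩
end
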